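/- arXiv:2406.16365 — 2 statements merged into one kernel-verified Lean document; each statement's English description precedes it below -/
import Mathlib

section
/- Let d ∈ ℕ and let a be a real number with 0 < a < min{2, d}. Then for every ε > 0 there exists a constant C = C(ε) > 0 such that for every Schwartz function u : ℝ^d → ℂ one has ∫_{ℝ^d} |x|^{−a} |u(x)|² dx ≤ ε · ∫_{ℝ^d} |∇u(x)|² dx + C · ∫_{ℝ^d} |u(x)|² dx. -/
open MeasureTheory

open Set Filter Topology Module

lemma exists_rpow_weight_interpolation {a : ℝ} (ha0 : 0 < a) (ha2 : a < 2) {B : ℝ} (hB : 0 ≤ B) :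
    ∃ C : ℝ, 0 ≤ C ∧ ∀ r : ℝ, 0 < r →
      B * (r ^ (-a) / (1 + r) * r) + B * (r ^ (-a) / (1 + r) * r) ^ 2
        ≤ r ^ (-a) / (1 + r) / 2 + C := by
  obtain ⟨ρ, hρ0, hρ⟩ : ∃ ρ : ℝ, 0 < ρ ∧ B * ρ + B * ρ ^ (2 - a) ≤ 1 / 2 := by
    have hlim : Tendsto (fun r : ℝ => B * r + B * r ^ (2 - a)) (𝓝[>] 0) (𝓝 (B * 0 + B * 0)) := by
      have h : Tendsto (fun r : ℝ => r ^ (2 - a)) (𝓝 0) (𝓝 0) := by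
        simpa [Real.zero_rpow (by linarith : 2 - a ≠ 0)] using
          (Real.continuousAt_rpow_const 0 (2 - a) (Or.inr (by linarith))).tendsto
      exact ((tendsto_id.const_mul B).add (h.const_mul B)).mono_left nhdsWithin_le_nhds
    have h := (hlim.eventually_le_const (u := 1 / 2) (by norm_num)).and self_mem_nhdsWithin
    obtain ⟨ρ, h1, h2⟩ := h.exists
    exact ⟨ρ, h2, h1⟩
  refine ⟨B * ρ ^ (-a) + B * (ρ ^ (-a)) ^ 2, by positivity, fun r hr => ?_⟩
  have hra : 0 < r ^ (-a) := by positivity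
  set w := r ^ (-a) / (1 + r) with hw
  have hw0 : 0 < w := by positivity
  rcases le_total r ρ with h | h
  · have hsq : (w * r) ^ 2 ≤ w * ρ ^ (2 - a) := by
      have h1 : w * r ^ 2 ≤ ρ ^ (2 - a) := by
        calc w * r ^ 2 ≤ r ^ (-a) * r ^ 2 := by
              gcongr
              exact div_le_self hra.le (by linarith)
          _ = r ^ (2 - a) := by
              rw [← Real.rpow_natCast r 2, ← Real.rpow_add hr]
              congr 1
              push_cast
              ring
          _ ≤ ρ ^ (2 - a) := Real.rpow_le_rpow hr.le h (by linarith)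
      calc (w * r) ^ 2 = w * (w * r ^ 2) := by ring
        _ ≤ _ := by gcongr
    calc B * (w * r) + B * (w * r) ^ 2 ≤ B * (w * ρ) + B * (w * ρ ^ (2 - a)) := by gcongr
      _ = w * (B * ρ + B * ρ ^ (2 - a)) := by ring
      _ ≤ w * (1 / 2) := by gcongr
      _ ≤ _ := by
        have : 0 ≤ B * ρ ^ (-a) + B * (ρ ^ (-a)) ^ 2 := by positivity
        linarith
  · have hm : w * r ≤ ρ ^ (-a) := by
      calc w * r = r ^ (-a) * (r / (1 + r)) := by rw [hw]; ring
        _ ≤ r ^ (-a) * 1 := by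
            gcongr
            rw [div_le_one (by linarith)]
            linarith
        _ ≤ ρ ^ (-a) := by
            rw [mul_one]
            exact Real.rpow_le_rpow_of_nonpos hρ0 h (by linarith)
    calc B * (w * r) + B * (w * r) ^ 2 ≤ B * ρ ^ (-a) + B * (ρ ^ (-a)) ^ 2 := by gcongr
      _ ≤ _ := by linarith

section

variable {E F : Type*} [NormedAddCommGroup E] [NormedSpace ℝ E] [NormedAddCommGroup F]

lemma lintegral_comp_pos_smul [FiniteDimensional ℝ E] [MeasurableSpace E] [BorelSpace E]
    (μ : Measure E) [μ.IsAddHaarMeasure] {f : E → ENNReal} (hf : Measurable f) {t : ℝ}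
    (ht : 0 < t) :
    ∫⁻ x, f (t • x) ∂μ = ENNReal.ofReal (t ^ (-(finrank ℝ E : ℝ))) * ∫⁻ x, f x ∂μ := by
  rw [← lintegral_map hf (measurable_const_smul t), Measure.map_addHaar_smul μ ht.ne',
    lintegral_smul_measure, abs_of_nonneg (by positivity), Real.rpow_neg ht.le,
    Real.rpow_natCast, smul_eq_mul]

lemma integrable_rpow_neg_norm_mul [FiniteDimensional ℝ E] [MeasurableSpace E] [BorelSpace E]
    (μ : Measure E) [μ.IsAddHaarMeasure] {a : ℝ} (ha0 : 0 < a) (had : a < finrank ℝ E)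
    {v : E → ℝ} (hv : Integrable v μ) {K : ℝ} (hK : ∀ x, ‖v x‖ ≤ K) :
    Integrable (fun x => ‖x‖ ^ (-a) * v x) μ := by
  have hd : 1 ≤ finrank ℝ E := by
    have : (0 : ℝ) < finrank ℝ E := ha0.trans had
    exact_mod_cast this
  have : Nontrivial E := finrank_pos_iff.1 (by omega : 0 < finrank ℝ E)
  have hball : Integrable (fun x : E => (Iio (1 : ℝ)).indicator (fun r => r ^ (-a)) ‖x‖) μ := by
    rw [integrable_fun_norm_addHaar μ (f := (Iio (1 : ℝ)).indicator (fun r => r ^ (-a)))]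
    have h1 : IntegrableOn (fun r : ℝ => r ^ ((finrank ℝ E : ℝ) - 1 - a)) (Ioo 0 1) :=
      (intervalIntegral.integrableOn_Ioo_rpow_iff one_pos).2 (by linarith)
    rw [← integrable_indicator_iff measurableSet_Ioi]
    refine ((integrable_indicator_iff measurableSet_Ioo).2 h1).congr (.of_forall fun r => ?_)
    by_cases h0 : 0 < r <;> by_cases hr : r < 1 <;> simp [h0, hr]
    rw [← Real.rpow_natCast, ← Real.rpow_add h0]
    congr 1
    push_cast [hd]
    ring
  have hmeas : AEStronglyMeasurable (fun x => ‖x‖ ^ (-a) * v x) μ :=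
    (measurable_norm.pow_const (-a)).aestronglyMeasurable.mul hv.1
  refine ((hball.mul_const K).add hv.norm).mono' hmeas (.of_forall fun x => ?_)
  have hvK := hK x
  have hv0 := norm_nonneg (v x)
  simp only [Pi.add_apply]
  rw [norm_mul, Real.norm_of_nonneg (by positivity : 0 ≤ ‖x‖ ^ (-a))]
  by_cases hx : ‖x‖ < 1
  · simp only [indicator, mem_Iio, hx, if_true]
    have : ‖x‖ ^ (-a) * ‖v x‖ ≤ ‖x‖ ^ (-a) * K := by gcongr
    linarith
  · simp only [indicator, mem_Iio, hx, if_false]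
    have : ‖x‖ ^ (-a) ≤ 1 := Real.rpow_le_one_of_one_le_of_nonpos (not_lt.1 hx) (by linarith)
    nlinarith

variable [InnerProductSpace ℝ F]

lemma ofReal_normSq_div_le_lintegral_ray {u : E → F} (hu : ContDiff ℝ 1 u) {K : ℝ}
    (hK : ∀ x, ‖u x‖ ≤ K) {x : E} (hx : x ≠ 0) :
    ENNReal.ofReal (‖u x‖ ^ 2 / (1 + ‖x‖)) ≤ ∫⁻ t in Ioi (1 : ℝ), ENNReal.ofReal (‖x‖ *
      ((‖u (t • x)‖ ^ 2 + 2 * ‖u (t • x)‖ * ‖fderiv ℝ u (t • x)‖) / (1 + ‖t • x‖))) := by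
  have hx0 : 0 < ‖x‖ := norm_pos_iff.2 hx
  set g : ℝ → ℝ := fun t => ‖u (t • x)‖ ^ 2 / (1 + t * ‖x‖) with hg
  set g' : ℝ → ℝ := fun t => (2 * inner ℝ (u (t • x)) (fderiv ℝ u (t • x) x) * (1 + t * ‖x‖)
    - ‖u (t • x)‖ ^ 2 * ‖x‖) / (1 + t * ‖x‖) ^ 2 with hg'
  have hpos : ∀ t : ℝ, 1 ≤ t → 0 < 1 + t * ‖x‖ := fun t ht => by positivity
  have hderiv : ∀ t : ℝ, 1 ≤ t → HasDerivAt g (g' t) t := by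
    intro t ht
    have h1 : HasDerivAt (fun s : ℝ => s • x) x t := by
      simpa using (hasDerivAt_id t).smul_const x
    have h2 : HasDerivAt (fun s : ℝ => u (s • x)) (fderiv ℝ u (t • x) x) t :=
      ((hu.differentiable one_ne_zero) (t • x)).hasFDerivAt.comp_hasDerivAt t h1
    have h3 : HasDerivAt (fun s : ℝ => 1 + s * ‖x‖) ‖x‖ t := by
      simpa using ((hasDerivAt_id t).mul_const ‖x‖).const_add 1
    exact h2.norm_sq.div h3 (hpos t ht).ne'
  have hcont : ContinuousOn g' (Ici 1) := by
    have h1 : Continuous fun t : ℝ => u (t • x) := hu.continuous.comp (by fun_prop)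
    have h2 : Continuous fun t : ℝ => fderiv ℝ u (t • x) x :=
      ((hu.continuous_fderiv one_ne_zero).comp (by fun_prop : Continuous fun t : ℝ => t • x)).clm_apply
        continuous_const
    have h3 : Continuous fun t : ℝ => inner ℝ (u (t • x)) (fderiv ℝ u (t • x) x) := h1.inner h2
    refine ContinuousOn.div (Continuous.continuousOn (by fun_prop)) (by fun_prop) fun t ht => ?_
    exact (pow_pos (hpos t ht) 2).ne'
  have hbound : ∀ t ∈ Ioi (1 : ℝ), ‖g' t‖ₑ ≤ ENNReal.ofReal (‖x‖ *
      ((‖u (t • x)‖ ^ 2 + 2 * ‖u (t • x)‖ * ‖fderiv ℝ u (t • x)‖) / (1 + ‖t • x‖))) := by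
    intro t ht
    have ht1 : (1 : ℝ) < t := ht
    have hs := hpos t ht1.le
    rw [← ofReal_norm, norm_smul, Real.norm_of_nonneg (by linarith : (0 : ℝ) ≤ t)]
    refine ENNReal.ofReal_le_ofReal ?_
    have hin : ‖inner ℝ (u (t • x)) (fderiv ℝ u (t • x) x)‖
        ≤ ‖u (t • x)‖ * (‖fderiv ℝ u (t • x)‖ * ‖x‖) :=
      (norm_inner_le_norm _ _).trans (by gcongr; exact ContinuousLinearMap.le_opNorm _ _)
    rw [hg', norm_div, Real.norm_of_nonneg (by positivity : 0 ≤ (1 + t * ‖x‖) ^ 2),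
      div_le_iff₀ (by positivity)]
    have hs1 : 1 ≤ 1 + t * ‖x‖ := by
      have : 0 ≤ t * ‖x‖ := by positivity
      linarith
    calc ‖2 * inner ℝ (u (t • x)) (fderiv ℝ u (t • x) x) * (1 + t * ‖x‖) - ‖u (t • x)‖ ^ 2 * ‖x‖‖
        ≤ 2 * ‖inner ℝ (u (t • x)) (fderiv ℝ u (t • x) x)‖ * (1 + t * ‖x‖)
          + ‖u (t • x)‖ ^ 2 * ‖x‖ := by
          refine (norm_sub_le _ _).trans_eq ?_
          simp [abs_of_pos hs]
      _ ≤ 2 * (‖u (t • x)‖ * (‖fderiv ℝ u (t • x)‖ * ‖x‖)) * (1 + t * ‖x‖)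
          + ‖u (t • x)‖ ^ 2 * ‖x‖ * (1 + t * ‖x‖) := by
          exact add_le_add (by gcongr) (le_mul_of_one_le_right (by positivity) hs1)
      _ = _ := by
          field_simp
          ring
  have hlim : Tendsto g atTop (𝓝 0) := by
    have h1 : Tendsto (fun t : ℝ => K ^ 2 / (1 + t * ‖x‖)) atTop (𝓝 0) :=
      (tendsto_atTop_add_const_left _ 1 (tendsto_id.atTop_mul_const hx0)).const_div_atTop _
    refine squeeze_zero' ?_ ?_ h1 <;> filter_upwards [eventually_ge_atTop 1] with t ht
    · exact div_nonneg (by positivity) (hpos t ht).le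
    · have := hK (t • x)
      have := (hpos t ht).le
      simp only [hg]
      gcongr
  have hlim' : Tendsto (fun T => ENNReal.ofReal (g 1 - g T)) atTop (𝓝 (ENNReal.ofReal (g 1))) := by
    simpa using ENNReal.tendsto_ofReal (hlim.const_sub (g 1))
  have hg1 : g 1 = ‖u x‖ ^ 2 / (1 + ‖x‖) := by simp [hg]
  rw [← hg1]
  refine le_of_tendsto hlim' ?_
  filter_upwards [eventually_ge_atTop 1] with T hT
  have hIcc : uIcc 1 T ⊆ Ici 1 := by
    rw [uIcc_of_le hT]
    exact Icc_subset_Ici_self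
  have hftc := intervalIntegral.integral_eq_sub_of_hasDerivAt
    (fun t ht => hderiv t (hIcc ht)) (hcont.mono hIcc).intervalIntegrable
  calc ENNReal.ofReal (g 1 - g T) ≤ ‖∫ t in Ioc 1 T, g' t‖ₑ := by
        rw [← intervalIntegral.integral_of_le hT, hftc, ← ofReal_norm]
        refine ENNReal.ofReal_le_ofReal ?_
        rw [norm_sub_rev]
        exact Real.le_norm_self _
    _ ≤ ∫⁻ t in Ioc 1 T, ‖g' t‖ₑ := enorm_integral_le_lintegral_enorm _
    _ ≤ ∫⁻ t in Ioi 1, ‖g' t‖ₑ := lintegral_mono_set Ioc_subset_Ioi_self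
    _ ≤ _ := setLIntegral_mono' measurableSet_Ioi hbound

lemma lintegral_rpow_neg_norm_mul_normSq_le [FiniteDimensional ℝ E] [MeasurableSpace E]
    [BorelSpace E] (μ : Measure E) [μ.IsAddHaarMeasure] {a : ℝ} (ha0 : 0 < a)
    (had : a < finrank ℝ E) {u : E → F} (hu : ContDiff ℝ 1 u) {K : ℝ} (hK : ∀ x, ‖u x‖ ≤ K) :
    ∫⁻ x, ENNReal.ofReal (‖x‖ ^ (-a) * (‖u x‖ ^ 2 / (1 + ‖x‖))) ∂μ
      ≤ ENNReal.ofReal (1 / (finrank ℝ E - a)) * ∫⁻ x, ENNReal.ofReal (‖x‖ ^ (-a) * (‖x‖ *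
        ((‖u x‖ ^ 2 + 2 * ‖u x‖ * ‖fderiv ℝ u x‖) / (1 + ‖x‖)))) ∂μ := by
  have hd : 0 < finrank ℝ E := by
    have : (0 : ℝ) < finrank ℝ E := ha0.trans had
    exact_mod_cast this
  have : Nontrivial E := finrank_pos_iff.1 hd
  have hc1 := hu.continuous
  have hc2 := hu.continuous_fderiv one_ne_zero
  set k : E → ℝ := fun y => (‖u y‖ ^ 2 + 2 * ‖u y‖ * ‖fderiv ℝ u y‖) / (1 + ‖y‖) with hk
  have hkc : Continuous k := by
    refine Continuous.div (by fun_prop) (by fun_prop) fun y => ?_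
    positivity
  set h : E → ENNReal := fun y => ENNReal.ofReal (‖y‖ ^ (-a) * (‖y‖ * k y)) with hh
  have hhm : Measurable h :=
    ((measurable_norm.pow_const (-a)).mul (measurable_norm.mul hkc.measurable)).ennreal_ofReal
  have hscale : ∀ x : E, ∀ t ∈ Ioi (1 : ℝ), ENNReal.ofReal (‖x‖ ^ (-a)) *
      ENNReal.ofReal (‖x‖ * k (t • x)) = ENNReal.ofReal (t ^ (a - 1)) * h (t • x) := by
    intro x t ht
    have ht0 : (0 : ℝ) < t := one_pos.trans ht
    rw [hh, ← ENNReal.ofReal_mul (by positivity), ← ENNReal.ofReal_mul (by positivity), norm_smul,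
      Real.norm_of_nonneg ht0.le, Real.mul_rpow ht0.le (norm_nonneg x)]
    congr 1
    have : t ^ (a - 1) * t ^ (-a) * t = 1 := by
      rw [← Real.rpow_add ht0, ← Real.rpow_add_one ht0.ne', ← Real.rpow_zero t]
      congr 1
      ring
    linear_combination (-(‖x‖ ^ (-a) * ‖x‖ * k (t • x))) * this
  calc ∫⁻ x, ENNReal.ofReal (‖x‖ ^ (-a) * (‖u x‖ ^ 2 / (1 + ‖x‖))) ∂μ
      ≤ ∫⁻ x, (∫⁻ t in Ioi (1 : ℝ), ENNReal.ofReal (t ^ (a - 1)) * h (t • x)) ∂μ := by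
        refine lintegral_mono_ae ?_
        filter_upwards [compl_mem_ae_iff.2 (measure_singleton (μ := μ) (0 : E))] with x hx
        rw [ENNReal.ofReal_mul (by positivity),
          ← setLIntegral_congr_fun measurableSet_Ioi (hscale x),
          lintegral_const_mul' _ _ ENNReal.ofReal_ne_top]
        gcongr
        exact ofReal_normSq_div_le_lintegral_ray hu hK hx
    _ = ∫⁻ t in Ioi (1 : ℝ), (∫⁻ x, ENNReal.ofReal (t ^ (a - 1)) * h (t • x) ∂μ) := by
        refine lintegral_lintegral_swap (Measurable.aemeasurable ?_)
        exact ((measurable_snd.pow_const (a - 1)).ennreal_ofReal).mul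
          (hhm.comp (measurable_snd.smul measurable_fst))
    _ = ∫⁻ t in Ioi (1 : ℝ), (ENNReal.ofReal (t ^ (a - 1 - finrank ℝ E)) * ∫⁻ x, h x ∂μ) := by
        refine setLIntegral_congr_fun measurableSet_Ioi fun t ht => ?_
        have ht0 : (0 : ℝ) < t := one_pos.trans ht
        rw [lintegral_const_mul' _ _ ENNReal.ofReal_ne_top, lintegral_comp_pos_smul μ hhm ht0,
          ← mul_assoc, ← ENNReal.ofReal_mul (by positivity), ← Real.rpow_add ht0, ← sub_eq_add_neg]
    _ = _ := by
        rw [lintegral_mul_const _ (by fun_prop), ← ofReal_integral_eq_lintegral_ofReal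
          (integrableOn_Ioi_rpow_of_lt (by linarith) one_pos), integral_Ioi_rpow_of_lt (by linarith)
          one_pos]
        · congr 2
          rw [Real.one_rpow, neg_div, ← div_neg]
          congr 1
          ring
        · filter_upwards [self_mem_ae_restrict measurableSet_Ioi] with t ht
          have ht0 : (0 : ℝ) < t := one_pos.trans ht
          simp only [Pi.zero_apply]
          positivity

end

/-- ε-form of the Hardy-type interpolation inequality. -/
theorem stmt_9 (d : ℕ) (a : ℝ) (ha0 : 0 < a) (ha2 : a < 2) (had : a < (d : ℝ)) :
    ∀ ε : ℝ, 0 < ε → ∃ C : ℝ, 0 < C ∧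
      ∀ u : SchwartzMap (EuclideanSpace ℝ (Fin d)) ℂ,
        (∫ x : EuclideanSpace ℝ (Fin d), ‖x‖ ^ (-a) * ‖u x‖ ^ 2)
          ≤ ε * (∫ x : EuclideanSpace ℝ (Fin d), ‖fderiv ℝ (⇑u) x‖ ^ 2)
              + C * ∫ x : EuclideanSpace ℝ (Fin d), ‖u x‖ ^ 2 := by
  intro ε hε
  have hda : 0 < (d : ℝ) - a := by linarith
  set c := 1 / ((d : ℝ) - a) with hc
  have hc0 : 0 < c := by positivity
  obtain ⟨C, hC0, hC⟩ := exists_rpow_weight_interpolation ha0 ha2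
    (B := c + 4 * c ^ 2 / ε) (by positivity)
  refine ⟨4 * C + 1, by positivity, fun u => ?_⟩
  have hfr : finrank ℝ (EuclideanSpace ℝ (Fin d)) = d := by simp
  have hu : ContDiff ℝ 1 u := u.smooth 1
  obtain ⟨K, hK⟩ : ∃ K : ℝ, ∀ x, ‖u x‖ ≤ K :=
    ⟨_, fun x => u.norm_le_seminorm ℝ x⟩
  have hV : Integrable (fun x => ‖u x‖ ^ 2) := (u.memLp 2).integrable_norm_pow two_ne_zero
  have hP : Integrable (fun x => ‖fderiv ℝ u x‖ ^ 2) :=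
    ((SchwartzMap.fderivCLM ℝ _ _ u).memLp 2 volume).integrable_norm_pow two_ne_zero
  have hW : Integrable (fun x => ‖x‖ ^ (-a) * ‖u x‖ ^ 2) := by
    refine integrable_rpow_neg_norm_mul volume ha0 (by rwa [hfr]) hV (K := K ^ 2) fun x => ?_
    rw [norm_pow, norm_norm]
    gcongr
    exact hK x
  have hA : Integrable (fun x => ‖x‖ ^ (-a) * (‖u x‖ ^ 2 / (1 + ‖x‖))) := by
    refine hW.mono' ?_ (.of_forall fun x => ?_)
    · exact ((measurable_norm.pow_const (-a)).mul
        ((u.continuous.measurable.norm.pow_const 2).div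
          (measurable_norm.const_add 1))).aestronglyMeasurable
    · rw [Real.norm_of_nonneg (by positivity)]
      gcongr
      exact div_le_self (by positivity) (by linarith [norm_nonneg x])
  set A := ∫ x, ‖x‖ ^ (-a) * (‖u x‖ ^ 2 / (1 + ‖x‖)) with hAdef
  set V := ∫ x, ‖u x‖ ^ 2 with hVdef
  set P := ∫ x, ‖fderiv ℝ u x‖ ^ 2 with hPdef
  have hpt : ∀ x : EuclideanSpace ℝ (Fin d), x ≠ 0 →
      c * (‖x‖ ^ (-a) * (‖x‖ * ((‖u x‖ ^ 2 + 2 * ‖u x‖ * ‖fderiv ℝ u x‖) / (1 + ‖x‖))))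
        ≤ 1 / 2 * (‖x‖ ^ (-a) * (‖u x‖ ^ 2 / (1 + ‖x‖))) + ε / 4 * ‖fderiv ℝ u x‖ ^ 2
          + C * ‖u x‖ ^ 2 := by
    intro x hx
    have hx0 : 0 < ‖x‖ := norm_pos_iff.2 hx
    have h := hC ‖x‖ hx0
    set m := ‖x‖ ^ (-a) / (1 + ‖x‖) * ‖x‖ with hm
    have hm0 : 0 ≤ m := by positivity
    have h1 := mul_le_mul_of_nonneg_right h (sq_nonneg ‖u x‖)
    have h2 : 2 * c * m * ‖u x‖ * ‖fderiv ℝ u x‖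
        ≤ ε / 4 * ‖fderiv ℝ u x‖ ^ 2 + 4 * c ^ 2 / ε * m ^ 2 * ‖u x‖ ^ 2 := by
      have := mul_nonneg (by positivity : 0 ≤ 1 / (4 * ε))
        (sq_nonneg (ε * ‖fderiv ℝ u x‖ - 4 * c * m * ‖u x‖))
      have e : 1 / (4 * ε) * (ε * ‖fderiv ℝ u x‖ - 4 * c * m * ‖u x‖) ^ 2
        = ε / 4 * ‖fderiv ℝ u x‖ ^ 2 + 4 * c ^ 2 / ε * m ^ 2 * ‖u x‖ ^ 2
          - 2 * c * m * ‖u x‖ * ‖fderiv ℝ u x‖ := by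
        field_simp
        ring
      linarith
    have h3 : 0 ≤ c * m ^ 2 * ‖u x‖ ^ 2 := by positivity
    have h4 : 0 ≤ 4 * c ^ 2 / ε * m * ‖u x‖ ^ 2 := by positivity
    calc _ = c * m * ‖u x‖ ^ 2 + 2 * c * m * ‖u x‖ * ‖fderiv ℝ u x‖ := by rw [hm]; ring
      _ ≤ (‖x‖ ^ (-a) / (1 + ‖x‖) / 2 + C) * ‖u x‖ ^ 2 + ε / 4 * ‖fderiv ℝ u x‖ ^ 2 := by
          linarith
      _ = _ := by ring
  have hR : Integrable (fun x => 1 / 2 * (‖x‖ ^ (-a) * (‖u x‖ ^ 2 / (1 + ‖x‖)))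
      + ε / 4 * ‖fderiv ℝ u x‖ ^ 2 + C * ‖u x‖ ^ 2) :=
    ((hA.const_mul _).add (hP.const_mul _)).add (hV.const_mul _)
  have hRint : ∫ x, (1 / 2 * (‖x‖ ^ (-a) * (‖u x‖ ^ 2 / (1 + ‖x‖)))
      + ε / 4 * ‖fderiv ℝ u x‖ ^ 2 + C * ‖u x‖ ^ 2) = 1 / 2 * A + ε / 4 * P + C * V := by
    rw [integral_add (by exact (hA.const_mul _).add (hP.const_mul _)) (hV.const_mul _),
      integral_add (hA.const_mul _) (hP.const_mul _), integral_const_mul, integral_const_mul,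
      integral_const_mul]
  have hne : ∀ᵐ x : EuclideanSpace ℝ (Fin d), x ≠ 0 := by
    have : Nontrivial (EuclideanSpace ℝ (Fin d)) := by
      refine finrank_pos_iff (R := ℝ).1 ?_
      rw [hfr]
      exact_mod_cast ha0.trans had
    exact compl_mem_ae_iff.2 (measure_singleton 0)
  have hAle : A ≤ 1 / 2 * A + ε / 4 * P + C * V := by
    rw [← hRint]
    refine (ENNReal.ofReal_le_ofReal_iff (integral_nonneg fun x => by positivity)).1 ?_
    rw [hAdef, ofReal_integral_eq_lintegral_ofReal hA (.of_forall fun x => by positivity),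
      ofReal_integral_eq_lintegral_ofReal hR (.of_forall fun x => by positivity)]
    refine (lintegral_rpow_neg_norm_mul_normSq_le volume ha0 (by rwa [hfr]) hu hK).trans ?_
    rw [hfr, ← lintegral_const_mul' _ _ ENNReal.ofReal_ne_top]
    refine lintegral_mono_ae (hne.mono fun x hx => ?_)
    rw [← ENNReal.ofReal_mul hc0.le]
    exact ENNReal.ofReal_le_ofReal (hpt x hx)
  have hfinal : ∫ x, ‖x‖ ^ (-a) * ‖u x‖ ^ 2 ≤ 2 * A + V := by
    rw [hAdef, hVdef, ← integral_const_mul, ← integral_add (hA.const_mul _) hV]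
    refine integral_mono hW ((hA.const_mul _).add hV) fun x => ?_
    have hw0 : 0 ≤ ‖x‖ ^ (-a) := by positivity
    have hweight : ‖x‖ ^ (-a) ≤ 2 * (‖x‖ ^ (-a) / (1 + ‖x‖)) + 1 := by
      rcases le_total ‖x‖ 1 with h | h
      · have : ‖x‖ ^ (-a) / 2 ≤ ‖x‖ ^ (-a) / (1 + ‖x‖) := by
          gcongr
          linarith
        linarith
      · have : ‖x‖ ^ (-a) ≤ 1 := Real.rpow_le_one_of_one_le_of_nonpos h (by linarith)
        have : 0 ≤ ‖x‖ ^ (-a) / (1 + ‖x‖) := by positivity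
        linarith
    calc ‖x‖ ^ (-a) * ‖u x‖ ^ 2
        ≤ (2 * (‖x‖ ^ (-a) / (1 + ‖x‖)) + 1) * ‖u x‖ ^ 2 := by gcongr
      _ = _ := by ring
  linarith
end

section
/- Let d ≥ 3 be a natural number, let b be a real number with 0 < b < 2, let ε > 0, set q = 2(d − b)/(d − 2), and define W_b : ℝ^d → ℝ by W_b(x) = [ε(d−b)(d−2)]^{(d−2)/(4−2b)} / (ε + |x|^{2−b})^{(d−2)/(2−b)}. Define the energy E_b(W_b) = (1/2) ∫_{ℝ^d} |∇W_b(x)|² dx − (1/q) ∫_{ℝ^d} |x|^{−b} W_b(x)^{q} dx. Then E_b(W_b) = ((2 − b)/(2(d − b))) · ∫_{ℝ^d} |∇W_b(x)|² dx. -/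
open MeasureTheory

open Set Filter Topology

lemma integrableOn_Ioi_rpow_mul_add_rpow {s a m ε : ℝ} (hε : 0 < ε) (hm : 0 ≤ m)
    (hs : -1 < s) (hsm : s - a * m < -1) :
    IntegrableOn (fun r : ℝ => r ^ s * (ε + r ^ a) ^ (-m)) (Ioi 0) := by
  have hmeas : Measurable (fun r : ℝ => r ^ s * (ε + r ^ a) ^ (-m)) := by fun_prop
  rw [← Ioc_union_Ioi_eq_Ioi zero_le_one]
  refine IntegrableOn.union ?_ ?_
  · have h : IntegrableOn (fun r : ℝ => r ^ s * ε ^ (-m)) (Ioc 0 1) := by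
      refine Integrable.mul_const ?_ _
      exact (intervalIntegrable_iff_integrableOn_Ioc_of_le zero_le_one).1
        (intervalIntegral.intervalIntegrable_rpow' hs)
    refine Integrable.mono' h hmeas.aestronglyMeasurable ?_
    filter_upwards [ae_restrict_mem measurableSet_Ioc] with r hr
    have hr0 : 0 < r := hr.1
    rw [Real.norm_of_nonneg (by positivity)]
    gcongr 1
    exact Real.rpow_le_rpow_of_nonpos hε (by linarith [Real.rpow_nonneg hr0.le a]) (by linarith)
  · refine Integrable.mono' (integrableOn_Ioi_rpow_of_lt hsm one_pos)
      hmeas.aestronglyMeasurable ?_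
    filter_upwards [ae_restrict_mem measurableSet_Ioi] with r hr
    have hr0 : 0 < r := one_pos.trans hr
    rw [Real.norm_of_nonneg (by positivity), sub_eq_add_neg, Real.rpow_add hr0, ← mul_neg,
      Real.rpow_mul hr0.le]
    gcongr 1
    exact Real.rpow_le_rpow_of_nonpos (by positivity) (by linarith) (by linarith)

lemma integral_Ioi_rpow_mul_add_rpow_recurrence {s a m ε : ℝ} (hε : 0 < ε) (ha : 0 < a)
    (hs : 0 < s) (hsm : s < a * m) :
    s * ε * ∫ r in Ioi (0 : ℝ), r ^ (s - 1) * (ε + r ^ a) ^ (-(m + 1)) =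
      (a * m - s) * ∫ r in Ioi (0 : ℝ), r ^ (s + a - 1) * (ε + r ^ a) ^ (-(m + 1)) := by
  have hm : 0 < m := pos_of_mul_pos_right (hs.trans hsm) ha.le
  have h₁ := (integrableOn_Ioi_rpow_mul_add_rpow (s := s - 1) (a := a) (m := m + 1) hε
    (by linarith) (by linarith) (by linarith)).const_mul (s * ε)
  have h₂ := (integrableOn_Ioi_rpow_mul_add_rpow (s := s + a - 1) (a := a) (m := m + 1) hε
    (by linarith) (by linarith) (by linarith)).const_mul (a * m - s)
  rw [← integral_const_mul, ← integral_const_mul, ← sub_eq_zero, ← integral_sub h₁ h₂]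
  have hlim : Tendsto (fun r : ℝ => r ^ s * (ε + r ^ a) ^ (-m)) atTop (𝓝 0) := by
    refine squeeze_zero' ?_ ?_ (tendsto_rpow_neg_atTop (sub_pos.2 hsm))
    · filter_upwards [eventually_gt_atTop 0] with r hr
      positivity
    · filter_upwards [eventually_gt_atTop 0] with r hr
      rw [neg_sub, sub_eq_add_neg, Real.rpow_add hr, ← mul_neg, Real.rpow_mul hr.le]
      gcongr 1
      exact Real.rpow_le_rpow_of_nonpos (by positivity) (by linarith) (by linarith)
  have hcont : ContinuousWithinAt (fun r : ℝ => r ^ s * (ε + r ^ a) ^ (-m)) (Ici 0) 0 := by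
    refine ContinuousAt.continuousWithinAt ?_
    refine (Real.continuousAt_rpow_const _ _ (Or.inr hs.le)).mul ?_
    refine (continuousAt_const.add (Real.continuousAt_rpow_const _ _ (Or.inr ha.le))).rpow_const
      (Or.inl ?_)
    simp [Real.zero_rpow ha.ne', hε.ne']
  refine (integral_Ioi_of_hasDerivAt_of_tendsto hcont ?_ (h₁.sub h₂) hlim).trans ?_
  rotate_left
  · simp [Real.zero_rpow hs.ne']
  · intro r hr
    have hr0 : 0 < r := hr
    have hpos : 0 < ε + r ^ a := by positivity
    have hd := (Real.hasDerivAt_rpow_const (x := r) (p := s) (Or.inl hr0.ne')).mul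
      (((Real.hasDerivAt_rpow_const (x := r) (p := a) (Or.inl hr0.ne')).const_add ε).rpow_const
        (p := -m) (Or.inl hpos.ne'))
    refine hd.congr_deriv ?_
    have e₁ : (ε + r ^ a) ^ (-m) = (ε + r ^ a) ^ (-(m + 1)) * (ε + r ^ a) := by
      rw [← Real.rpow_add_one hpos.ne']; congr 1; ring
    have e₂ : r ^ s = r ^ (s - 1) * r := by
      rw [← Real.rpow_add_one hr0.ne']; congr 1; ring
    have e₃ : r ^ (s + a - 1) = r ^ (s - 1) * r ^ a := by
      rw [← Real.rpow_add hr0]; congr 1; ring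
    have e₄ : r ^ a = r ^ (a - 1) * r := by
      rw [← Real.rpow_add_one hr0.ne']; congr 1; ring
    have e₅ : -m - 1 = -(m + 1) := by ring
    simp only [Pi.sub_apply]
    rw [e₁, e₃, e₂, e₅, e₄]
    ring

lemma norm_fderiv_comp_norm {E : Type*} [NormedAddCommGroup E] [InnerProductSpace ℝ E]
    [Nontrivial E] {f : ℝ → ℝ} {f' : ℝ} {x : E} (hx : x ≠ 0) (hf : HasDerivAt f f' ‖x‖) :
    ‖fderiv ℝ (fun y : E => f ‖y‖) x‖ = |f'| := by
  have hn : DifferentiableAt ℝ (fun y : E => ‖y‖) x := differentiableAt_id.norm ℝ hx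
  have h := hf.comp_hasFDerivAt x hn.hasFDerivAt
  change HasFDerivAt (fun y : E => f ‖y‖) _ x at h
  rw [h.fderiv, norm_smul, norm_fderiv_norm hn, mul_one, Real.norm_eq_abs]

lemma hasDerivAt_const_div_add_rpow {C ε a p r : ℝ} (hε : 0 < ε) (hr : 0 < r) :
    HasDerivAt (fun r : ℝ => C / (ε + r ^ a) ^ p)
      (-(C * (a * p) * r ^ (a - 1) * (ε + r ^ a) ^ (-(p + 1)))) r := by
  have hpos : 0 < ε + r ^ a := by positivity
  have hd := (((Real.hasDerivAt_rpow_const (x := r) (p := a) (Or.inl hr.ne')).const_add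
    ε).rpow_const (p := -p) (Or.inl hpos.ne')).const_mul C
  have e : -p - 1 = -(p + 1) := by ring
  rw [e] at hd
  refine (hd.congr_deriv (by ring)).congr_of_eventuallyEq ?_
  filter_upwards [eventually_gt_nhds hr] with y hy
  rw [Real.rpow_neg (by positivity), div_eq_mul_inv]

/-- The Pohozaev-type identity: the kinetic and potential integrals of `W_b` coincide. -/
lemma integral_norm_fderiv_sq_eq_integral_potential (d : ℕ) (hd : 3 ≤ d) (b ε q : ℝ)
    (hb2 : b < 2) (hε : 0 < ε) (hq : q = 2 * ((d : ℝ) - b) / ((d : ℝ) - 2))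
    (W : EuclideanSpace ℝ (Fin d) → ℝ)
    (hW : ∀ x, W x = (ε * ((d : ℝ) - b) * ((d : ℝ) - 2)) ^ (((d : ℝ) - 2) / (4 - 2 * b)) /
        (ε + ‖x‖ ^ (2 - b)) ^ (((d : ℝ) - 2) / (2 - b))) :
    ∫ x : EuclideanSpace ℝ (Fin d), ‖fderiv ℝ W x‖ ^ 2 =
      ∫ x : EuclideanSpace ℝ (Fin d), ‖x‖ ^ (-b) * W x ^ q := by
  have hd3 : (3 : ℝ) ≤ d := by exact_mod_cast hd
  have : Nonempty (Fin d) := ⟨⟨0, by omega⟩⟩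
  have hdb : 0 < (d : ℝ) - b := by linarith
  have hd2 : 0 < (d : ℝ) - 2 := by linarith
  have ha : 0 < 2 - b := by linarith
  have h4 : 0 < 4 - 2 * b := by linarith
  set A : ℝ := ε * ((d : ℝ) - b) * ((d : ℝ) - 2) with hA
  have hApos : 0 < A := by positivity
  set C : ℝ := A ^ (((d : ℝ) - 2) / (4 - 2 * b)) with hC
  have hCpos : 0 < C := by positivity
  set p : ℝ := ((d : ℝ) - 2) / (2 - b) with hp
  have hap : (2 - b) * p = d - 2 := by rw [hp]; field_simp
  have hpq : p * q = 2 * p + 2 := by rw [hp, hq]; field_simp; ring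
  have hCq : C ^ q = C ^ 2 * A := by
    have h2 : (C ^ 2 : ℝ) = A ^ (((d : ℝ) - 2) / (4 - 2 * b) * 2) := by
      rw [Real.rpow_mul hApos.le, ← hC]; norm_cast
    rw [h2, ← Real.rpow_add_one hApos.ne', hC, ← Real.rpow_mul hApos.le, hq]
    congr 1
    field_simp
    ring
  have hWfun : W = fun x => C / (ε + ‖x‖ ^ (2 - b)) ^ p := funext hW
  have hkin : ∫ x : EuclideanSpace ℝ (Fin d), ‖fderiv ℝ W x‖ ^ 2 =
      ∫ x : EuclideanSpace ℝ (Fin d),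
        (C * (d - 2) * ‖x‖ ^ (2 - b - 1) * (ε + ‖x‖ ^ (2 - b)) ^ (-(p + 1))) ^ 2 := by
    refine integral_congr_ae ?_
    filter_upwards [compl_mem_ae_iff.2 (measure_singleton (0 : EuclideanSpace ℝ (Fin d)))]
      with x hx
    have hx0 : x ≠ 0 := hx
    rw [hWfun, norm_fderiv_comp_norm (f := fun r => C / (ε + r ^ (2 - b)) ^ p) hx0
      (hasDerivAt_const_div_add_rpow hε (norm_pos_iff.2 hx0)), sq_abs, hap, neg_sq]
  have hrec := integral_Ioi_rpow_mul_add_rpow_recurrence (s := d - b) (a := 2 - b)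
    (m := 2 * p + 1) hε ha hdb (by linarith)
  have hradial : ∀ {r : ℝ}, 0 < r → r ^ (d - 1) = r ^ ((d : ℝ) - 1) := by
    intro r hr
    rw [← Real.rpow_natCast, Nat.cast_sub (by omega), Nat.cast_one]
  rw [hkin, hWfun,
    integral_fun_norm_addHaar volume (fun r : ℝ =>
      (C * (d - 2) * r ^ (2 - b - 1) * (ε + r ^ (2 - b)) ^ (-(p + 1))) ^ 2),
    integral_fun_norm_addHaar volume (fun r : ℝ =>
      r ^ (-b) * (C / (ε + r ^ (2 - b)) ^ p) ^ q)]
  congr 2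
  rw [finrank_euclideanSpace_fin]
  have hleft : ∫ r in Ioi (0 : ℝ), r ^ (d - 1) •
        (C * (d - 2) * r ^ (2 - b - 1) * (ε + r ^ (2 - b)) ^ (-(p + 1))) ^ 2 =
      C ^ 2 * (d - 2) ^ 2 * ∫ r in Ioi (0 : ℝ),
        r ^ (d - b + (2 - b) - 1) * (ε + r ^ (2 - b)) ^ (-(2 * p + 1 + 1)) := by
    rw [← integral_const_mul]
    refine setIntegral_congr_fun measurableSet_Ioi fun r hr => ?_
    have hr0 : 0 < r := hr
    have hpos : 0 < ε + r ^ (2 - b) := by positivity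
    have e₁ : r ^ (d - b + (2 - b) - 1) = r ^ ((d : ℝ) - 1) * (r ^ (2 - b - 1)) ^ 2 := by
      rw [sq, ← Real.rpow_add hr0, ← Real.rpow_add hr0]; congr 1; ring
    have e₂ : (ε + r ^ (2 - b)) ^ (-(2 * p + 1 + 1)) =
        ((ε + r ^ (2 - b)) ^ (-(p + 1))) ^ 2 := by
      rw [sq, ← Real.rpow_add hpos]; congr 1; ring
    simp only [smul_eq_mul]
    rw [hradial hr0, e₁, e₂]
    ring
  have hright : ∫ r in Ioi (0 : ℝ), r ^ (d - 1) •
        (r ^ (-b) * (C / (ε + r ^ (2 - b)) ^ p) ^ q) =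
      C ^ 2 * A * ∫ r in Ioi (0 : ℝ),
        r ^ (d - b - 1) * (ε + r ^ (2 - b)) ^ (-(2 * p + 1 + 1)) := by
    rw [← integral_const_mul]
    refine setIntegral_congr_fun measurableSet_Ioi fun r hr => ?_
    have hr0 : 0 < r := hr
    have hpos : 0 < ε + r ^ (2 - b) := by positivity
    have e₁ : r ^ (d - b - 1) = r ^ ((d : ℝ) - 1) * r ^ (-b) := by
      rw [← Real.rpow_add hr0]; congr 1; ring
    have e₂ : (C / (ε + r ^ (2 - b)) ^ p) ^ q =
        C ^ 2 * A * (ε + r ^ (2 - b)) ^ (-(2 * p + 1 + 1)) := by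
      rw [Real.div_rpow hCpos.le (by positivity), hCq, ← Real.rpow_mul hpos.le, hpq,
        div_eq_mul_inv, ← Real.rpow_neg hpos.le]
      ring_nf
    simp only [smul_eq_mul]
    rw [hradial hr0, e₁, e₂]
    ring
  rw [hleft, hright]
  have hcoef : (2 - b) * (2 * p + 1) - (d - b) = d - 2 := by linarith
  rw [hcoef] at hrec
  rw [hA]
  linear_combination -(C ^ 2 * (d - 2)) * hrec

/-- Energy identity for the energy-critical ground state `W_b`. -/
theorem stmt_13 (d : ℕ) (hd : 3 ≤ d) (b ε q : ℝ) (hb0 : 0 < b) (hb2 : b < 2) (hε : 0 < ε)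
    (hq : q = 2 * ((d : ℝ) - b) / ((d : ℝ) - 2))
    (W : EuclideanSpace ℝ (Fin d) → ℝ)
    (hW : ∀ x, W x = (ε * ((d : ℝ) - b) * ((d : ℝ) - 2)) ^ (((d : ℝ) - 2) / (4 - 2 * b)) /
        (ε + ‖x‖ ^ (2 - b)) ^ (((d : ℝ) - 2) / (2 - b))) :
    (1 / 2) * (∫ x : EuclideanSpace ℝ (Fin d), ‖fderiv ℝ W x‖ ^ 2)
        - (1 / q) * (∫ x : EuclideanSpace ℝ (Fin d), ‖x‖ ^ (-b) * W x ^ q)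
      = ((2 - b) / (2 * ((d : ℝ) - b))) *
          ∫ x : EuclideanSpace ℝ (Fin d), ‖fderiv ℝ W x‖ ^ 2 := by
  rw [← integral_norm_fderiv_sq_eq_integral_potential d hd b ε q hb2 hε hq W hW, ← sub_mul, hq]
  have hd3 : (3 : ℝ) ≤ d := by exact_mod_cast hd
  have hdb : (d : ℝ) - b ≠ 0 := by linarith
  have hd2 : (d : ℝ) - 2 ≠ 0 := by linarith
  congr 1
  field_simp
  ring
end
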